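/- The only idempotents of the even Clifford algebra A of the quadratic form diag(1,1,0) on ℂ³ that are central in A are 0 and 1; that is, if b ∈ A satisfies b² = b and b·a = a·b for all a ∈ A, then b = 0 or b = 1. In particular A is a connected algebra. -/

import Mathlib

open CliffordAlgebra

noncomputable section

/-- The quadratic form `v ↦ v₀² + v₁²` on `ℂ³`, with Gram matrix `diag(1,1,0)` —
the quadratic form of a corank-1 degenerate conic. -/
def Q : QuadraticForm ℂ (Fin 3 → ℂ) := QuadraticMap.weightedSumSquares ℂ ![1, 1, 0]

/-- The standard basis vectors `e₁, e₂, e₃` of `ℂ³` (indexed by `0, 1, 2`). -/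
def e (j : Fin 3) : Fin 3 → ℂ := Pi.single j 1

/-- `x = i·ι(e₁)·ι(e₂)` in the Clifford algebra of `Q`. -/
def x : CliffordAlgebra Q := Complex.I • (ι Q (e 0) * ι Q (e 1))

/-- `y = i·ι(e₂)·ι(e₃)` in the Clifford algebra of `Q`. -/
def y : CliffordAlgebra Q := Complex.I • (ι Q (e 1) * ι Q (e 2))

/-- `z = ι(e₁)·ι(e₃)` in the Clifford algebra of `Q`. -/
def z : CliffordAlgebra Q := ι Q (e 0) * ι Q (e 2)

lemma x_mem : x ∈ even Q := Subalgebra.smul_mem _ (ι_mul_ι_mem_evenOdd_zero Q _ _) _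

lemma y_mem : y ∈ even Q := Subalgebra.smul_mem _ (ι_mul_ι_mem_evenOdd_zero Q _ _) _

lemma z_mem : z ∈ even Q := ι_mul_ι_mem_evenOdd_zero Q _ _

/-- `x` as an element of the even Clifford algebra `A = CliffordAlgebra.even Q`. -/
def xA : even Q := ⟨x, x_mem⟩

/-- `y` as an element of the even Clifford algebra `A = CliffordAlgebra.even Q`. -/
def yA : even Q := ⟨y, y_mem⟩

/-- `z` as an element of the even Clifford algebra `A = CliffordAlgebra.even Q`. -/
def zA : even Q := ⟨z, z_mem⟩

lemma Q_apply (v : Fin 3 → ℂ) : Q v = v 0 * v 0 + v 1 * v 1 := by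
  simp [Q, QuadraticMap.weightedSumSquares_apply, Fin.sum_univ_three]

lemma ι_e_zero_sq : ι Q (e 0) * ι Q (e 0) = 1 := by
  simp [ι_sq_scalar, Q_apply, e]

lemma ι_e_one_sq : ι Q (e 1) * ι Q (e 1) = 1 := by
  simp [ι_sq_scalar, Q_apply, e]

lemma ι_e_two_sq : ι Q (e 2) * ι Q (e 2) = 0 := by
  simp [ι_sq_scalar, Q_apply, e]

lemma ι_e_anticomm {i j : Fin 3} (h : i ≠ j) :
    ι Q (e i) * ι Q (e j) = -(ι Q (e j) * ι Q (e i)) := by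
  apply ι_mul_ι_comm_of_isOrtho
  rw [QuadraticMap.isOrtho_def]
  fin_cases i <;> fin_cases j <;> simp_all [Q_apply, e]

lemma ι_eq_sum (v : Fin 3 → ℂ) :
    ι Q v = v 0 • ι Q (e 0) + v 1 • ι Q (e 1) + v 2 • ι Q (e 2) := by
  simp only [← map_smul, ← map_add]
  congr 1
  ext i
  fin_cases i <;> simp [e]

/-- Multiplication rules of three generators `a`, `b`, `c` with `a² = b² = 1`, `c² = 0` that
anticommute pairwise. -/
structure CliffordRelations {R : Type*} [Ring R] (a b c : R) : Prop where
  aa : a * a = 1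
  bb : b * b = 1
  cc : c * c = 0
  ba : b * a = -(a * b)
  ca : c * a = -(a * c)
  cb : c * b = -(b * c)

namespace CliffordRelations

variable {R : Type*} [Ring R] {a b c : R}

lemma aa_assoc (h : CliffordRelations a b c) (r : R) : a * (a * r) = r := by
  rw [← mul_assoc, h.aa, one_mul]

lemma bb_assoc (h : CliffordRelations a b c) (r : R) : b * (b * r) = r := by
  rw [← mul_assoc, h.bb, one_mul]

lemma ba_assoc (h : CliffordRelations a b c) (r : R) : b * (a * r) = -(a * (b * r)) := by
  rw [← mul_assoc, h.ba, neg_mul, mul_assoc]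

lemma ca_assoc (h : CliffordRelations a b c) (r : R) : c * (a * r) = -(a * (c * r)) := by
  rw [← mul_assoc, h.ca, neg_mul, mul_assoc]

lemma cb_assoc (h : CliffordRelations a b c) (r : R) : c * (b * r) = -(b * (c * r)) := by
  rw [← mul_assoc, h.cb, neg_mul, mul_assoc]

end CliffordRelations

lemma cliffordRelations_ι : CliffordRelations (ι Q (e 0)) (ι Q (e 1)) (ι Q (e 2)) where
  aa := ι_e_zero_sq
  bb := ι_e_one_sq
  cc := ι_e_two_sq
  ba := ι_e_anticomm (by decide)
  ca := ι_e_anticomm (by decide)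
  cb := ι_e_anticomm (by decide)

lemma exists_coeff_of_mem_even {u : CliffordAlgebra Q} (hu : u ∈ even Q) :
    ∃ p q r s : ℂ, u = p • 1 + q • (ι Q (e 0) * ι Q (e 1)) + r • (ι Q (e 1) * ι Q (e 2))
      + s • (ι Q (e 0) * ι Q (e 2)) := by
  have h := cliffordRelations_ι
  induction u, hu using even_induction with
  | algebraMap t => exact ⟨t, 0, 0, 0, by simp [Algebra.algebraMap_eq_smul_one]⟩
  | add _ _ _ _ h₁ h₂ =>
    obtain ⟨p, q, r, s, rfl⟩ := h₁
    obtain ⟨p', q', r', s', rfl⟩ := h₂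
    exact ⟨p + p', q + q', r + r', s + s', by module⟩
  | ι_mul_ι_mul v w _ _ ih =>
    obtain ⟨p, q, r, s, rfl⟩ := ih
    rw [ι_eq_sum v, ι_eq_sum w]
    generalize ι Q (e 0) = a at *
    generalize ι Q (e 1) = b at *
    generalize ι Q (e 2) = c at *
    let P := v 0 * w 0 + v 1 * w 1
    let A := v 0 * w 1 - v 1 * w 0
    let B := v 1 * w 2 - v 2 * w 1
    let C := v 0 * w 2 - v 2 * w 0
    refine ⟨P * p - A * q, P * q + A * p, P * r + B * p - A * s + C * q,
      P * s + C * p + A * r - B * q, ?_⟩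
    simp only [mul_add, add_mul, smul_mul_assoc, mul_smul_comm, mul_assoc, mul_one, h.aa, h.bb,
      h.cc, h.ba, h.ca, h.cb, h.aa_assoc, h.bb_assoc, h.ba_assoc, h.ca_assoc,
      h.cb_assoc, mul_neg, neg_neg, neg_mul, one_mul, zero_mul,
      smul_neg, mul_zero, smul_zero, neg_zero, P, A, B, C]
    module

lemma ι_e_zero_mul_ι_e_two_ne_zero : ι Q (e 0) * ι Q (e 2) ≠ 0 := by
  intro h0
  have h1 : ι Q (e 2) = 0 := by
    rw [← cliffordRelations_ι.aa_assoc (ι Q (e 2)), h0, mul_zero]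
  have h2 : e 2 = 0 := by
    have := congrArg (CliffordAlgebra.equivExterior Q) h1
    simpa using this
  simpa [e] using congrFun h2 2

/-- The only idempotents of the even Clifford algebra `A` of `diag(1,1,0)`
on `ℂ³` that are central in `A` are `0` and `1`: if `b ∈ A` satisfies `b² = b` and
`b·a = a·b` for all `a ∈ A`, then `b = 0` or `b = 1`.  In particular `A` is a connected
algebra. -/
theorem central_idempotents (b : even Q) (hb : b * b = b)
    (hcentral : ∀ a : even Q, b * a = a * b) :
    b = 0 ∨ b = 1 := by
  obtain ⟨b, hbm⟩ := b
  have hidem : b * b = b := congrArg Subtype.val hb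
  have hab := congrArg Subtype.val (hcentral ⟨_, ι_mul_ι_mem_evenOdd_zero Q (e 0) (e 1)⟩)
  have hbc := congrArg Subtype.val (hcentral ⟨_, ι_mul_ι_mem_evenOdd_zero Q (e 1) (e 2)⟩)
  have hne := ι_e_zero_mul_ι_e_two_ne_zero
  have h := cliffordRelations_ι
  suffices b = 0 ∨ b = 1 from this.imp (fun H => Subtype.ext H) (fun H => Subtype.ext H)
  change b * (ι Q (e 0) * ι Q (e 1)) = (ι Q (e 0) * ι Q (e 1)) * b at hab
  change b * (ι Q (e 1) * ι Q (e 2)) = (ι Q (e 1) * ι Q (e 2)) * b at hbc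
  clear hb hcentral
  obtain ⟨p, q, r, s, rfl⟩ := exists_coeff_of_mem_even hbm
  clear hbm
  generalize ι Q (e 0) = a at *
  generalize ι Q (e 1) = b at *
  generalize ι Q (e 2) = c at *
  simp only [mul_add, add_mul, smul_mul_assoc, mul_smul_comm, mul_assoc, mul_one, one_mul, h.aa,
    h.bb, h.cc, h.cb, h.aa_assoc, h.bb_assoc, h.ba_assoc, h.ca_assoc,
    h.cb_assoc, mul_neg, neg_neg, smul_neg, mul_zero, smul_zero,
    neg_zero] at hab hbc
  have hq : q = 0 := by
    have : (2 * q) • (a * c) = 0 := by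
      linear_combination (norm := module) hbc
    simpa [hne] using this
  have hrs : r • (b * c) + s • (a * c) = 0 := by
    have h1 : s • (b * c) - r • (a * c) = 0 := by
      have : (2 : ℂ) • (s • (b * c) - r • (a * c)) = 0 := by
        linear_combination (norm := module) hab
      simpa using this
    have h2 := congrArg (fun t => a * b * t) h1
    simp only [mul_sub, mul_smul_comm, mul_assoc, h.aa_assoc, h.bb_assoc, h.ba_assoc, mul_neg,
      smul_neg, mul_zero] at h2
    linear_combination (norm := module) h2
  have hscalar : p • (1 : CliffordAlgebra Q) + q • (a * b) + r • (b * c) + s • (a * c) = p • 1 := by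
    rw [add_assoc, hrs, hq, zero_smul, add_zero, add_zero]
  rw [hscalar] at hidem ⊢
  have hp : (p * p - p) • (a * c) = 0 := by
    have := congrArg (fun t => t * (a * c)) hidem
    simp only [smul_mul_assoc, one_mul, smul_smul] at this
    rw [sub_smul, this, sub_self]
  have hp' : p * (p - 1) = 0 := by
    linear_combination (smul_eq_zero.mp hp).resolve_right hne
  rcases mul_eq_zero.mp hp' with hp0 | hp1
  · exact Or.inl (by rw [hp0, zero_smul])
  · exact Or.inr (by rw [sub_eq_zero.mp hp1, one_smul])
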